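/- Let (A, ·, { , , }, ⦃ , , ⦄) be an associative-Yamaguti algebra, (M, ·, { , , }, ⦃ , , ⦄) a representation of it, and R : M → A a relative Rota-Baxter operator. Define on M, for u,v,w ∈ M: u≺v := u·R(v), u≻v := R(u)·v, {u,v,w}_1 := {u,R(v),R(w)}, {u,v,w}_2 := {R(u),v,R(w)}, {u,v,w}_3 := {R(u),R(v),w}, ⦃u,v,w⦄_1 := ⦃u,R(v),R(w)⦄, ⦃u,v,w⦄_2 := ⦃R(u),v,R(w)⦄, ⦃u,v,w⦄_3 := ⦃R(u),R(v),w⦄. Then (M, ≺, ≻, { , , }_1, { , , }_2, { , , }_3, ⦃ , , ⦄_1, ⦃ , , ⦄_2, ⦃ , , ⦄_3) is a dendriform-Yamaguti algebra, i.e. the identities (DY1A)–(DY11E) hold. -/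

import Mathlib

set_option maxHeartbeats 1000000

/-- An associative-Yamaguti algebra structure: a bilinear multiplication `mul` and
trilinear operations `tri` (`{ , , }`) and `tri'` (`⦃ , , ⦄`) satisfying (AY1)-(AY11). -/
structure IsAssYamaguti {k A : Type*} [Field k] [AddCommGroup A] [Module k A]
    (mul : A →ₗ[k] A →ₗ[k] A) (tri tri' : A →ₗ[k] A →ₗ[k] A →ₗ[k] A) : Prop where
  ay1 : ∀ a b c : A, mul (mul a b) c - mul a (mul b c) + tri a b c - tri' a b c = 0
  ay2 : ∀ a b c d : A, tri (mul a b) c d = tri a (mul b c) d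
  ay3 : ∀ a b c d : A, tri a b (mul c d) = mul (tri a b c) d
  ay4 : ∀ a b c d : A, tri' (mul a b) c d = mul a (tri' b c d)
  ay5 : ∀ a b c d : A, tri' a (mul b c) d = tri' a b (mul c d)
  ay6 : ∀ a b c d : A, mul a (tri b c d) = mul (tri' a b c) d
  ay7a : ∀ a b c d e : A, tri (tri a b c) d e = tri a (tri' b c d) e
  ay7b : ∀ a b c d e : A, tri a (tri' b c d) e = tri a b (tri c d e)
  ay8 : ∀ a b c d e : A, tri a (tri b c d) e = tri (tri' a b c) d e
  ay9a : ∀ a b c d e : A, tri' (tri' a b c) d e = tri' a (tri b c d) e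
  ay9b : ∀ a b c d e : A, tri' a (tri b c d) e = tri' a b (tri' c d e)
  ay10 : ∀ a b c d e : A, tri' a (tri' b c d) e = tri' a b (tri c d e)
  ay11 : ∀ a b c d e : A, tri a b (tri' c d e) = tri' (tri a b c) d e

/-- A representation of an associative-Yamaguti algebra `(A, mul, tri, tri')` on `M`:
actions `al : A × M → M` (`a·u`), `ar : M × A → M` (`u·a`) and trilinear actions
`t0,t1,t2` (for `{ , , }` with the `M`-slot in position 1,2,3) and `s0,s1,s2`
(for `⦃ , , ⦄`), satisfying the identities (AY1)-(AY11) whenever exactly one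
argument lies in `M` and the remaining arguments lie in `A`. -/
structure IsAssYRep {k A M : Type*} [Field k] [AddCommGroup A] [Module k A]
    [AddCommGroup M] [Module k M]
    (mul : A →ₗ[k] A →ₗ[k] A) (tri tri' : A →ₗ[k] A →ₗ[k] A →ₗ[k] A)
    (al : A →ₗ[k] M →ₗ[k] M) (ar : M →ₗ[k] A →ₗ[k] M)
    (t0 : M →ₗ[k] A →ₗ[k] A →ₗ[k] M) (t1 : A →ₗ[k] M →ₗ[k] A →ₗ[k] M)
    (t2 : A →ₗ[k] A →ₗ[k] M →ₗ[k] M)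
    (s0 : M →ₗ[k] A →ₗ[k] A →ₗ[k] M) (s1 : A →ₗ[k] M →ₗ[k] A →ₗ[k] M)
    (s2 : A →ₗ[k] A →ₗ[k] M →ₗ[k] M) : Prop where
  ay1a : ∀ (u : M) (b c : A), ar (ar u b) c - ar u (mul b c) + t0 u b c - s0 u b c = 0
  ay1b : ∀ (a : A) (v : M) (c : A), ar (al a v) c - al a (ar v c) + t1 a v c - s1 a v c = 0
  ay1c : ∀ (a b : A) (w : M), al (mul a b) w - al a (al b w) + t2 a b w - s2 a b w = 0
  ay2a : ∀ (u : M) (b c d : A), t0 (ar u b) c d = t0 u (mul b c) d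
  ay2b : ∀ (a : A) (v : M) (c d : A), t0 (al a v) c d = t1 a (ar v c) d
  ay2c : ∀ (a b : A) (w : M) (d : A), t1 (mul a b) w d = t1 a (al b w) d
  ay2d : ∀ (a b c : A) (x : M), t2 (mul a b) c x = t2 a (mul b c) x
  ay3a : ∀ (u : M) (b c d : A), t0 u b (mul c d) = ar (t0 u b c) d
  ay3b : ∀ (a : A) (v : M) (c d : A), t1 a v (mul c d) = ar (t1 a v c) d
  ay3c : ∀ (a b : A) (w : M) (d : A), t2 a b (ar w d) = ar (t2 a b w) d
  ay3d : ∀ (a b c : A) (x : M), t2 a b (al c x) = al (tri a b c) x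
  ay4a : ∀ (u : M) (b c d : A), s0 (ar u b) c d = ar u (tri' b c d)
  ay4b : ∀ (a : A) (v : M) (c d : A), s0 (al a v) c d = al a (s0 v c d)
  ay4c : ∀ (a b : A) (w : M) (d : A), s1 (mul a b) w d = al a (s1 b w d)
  ay4d : ∀ (a b c : A) (x : M), s2 (mul a b) c x = al a (s2 b c x)
  ay5a : ∀ (u : M) (b c d : A), s0 u (mul b c) d = s0 u b (mul c d)
  ay5b : ∀ (a : A) (v : M) (c d : A), s1 a (ar v c) d = s1 a v (mul c d)
  ay5c : ∀ (a b : A) (w : M) (d : A), s1 a (al b w) d = s2 a b (ar w d)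
  ay5d : ∀ (a b c : A) (x : M), s2 a (mul b c) x = s2 a b (al c x)
  ay6a : ∀ (u : M) (b c d : A), ar u (tri b c d) = ar (s0 u b c) d
  ay6b : ∀ (a : A) (v : M) (c d : A), al a (t0 v c d) = ar (s1 a v c) d
  ay6c : ∀ (a b : A) (w : M) (d : A), al a (t1 b w d) = ar (s2 a b w) d
  ay6d : ∀ (a b c : A) (x : M), al a (t2 b c x) = al (tri' a b c) x
  ay7a1 : ∀ (u : M) (b c d e : A), t0 (t0 u b c) d e = t0 u (tri' b c d) e
  ay7a2 : ∀ (u : M) (b c d e : A), t0 u (tri' b c d) e = t0 u b (tri c d e)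
  ay7b1 : ∀ (a : A) (v : M) (c d e : A), t0 (t1 a v c) d e = t1 a (s0 v c d) e
  ay7b2 : ∀ (a : A) (v : M) (c d e : A), t1 a (s0 v c d) e = t1 a v (tri c d e)
  ay7c1 : ∀ (a b : A) (w : M) (d e : A), t0 (t2 a b w) d e = t1 a (s1 b w d) e
  ay7c2 : ∀ (a b : A) (w : M) (d e : A), t1 a (s1 b w d) e = t2 a b (t0 w d e)
  ay7d1 : ∀ (a b c : A) (x : M) (e : A), t1 (tri a b c) x e = t1 a (s2 b c x) e
  ay7d2 : ∀ (a b c : A) (x : M) (e : A), t1 a (s2 b c x) e = t2 a b (t1 c x e)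
  ay7e1 : ∀ (a b c d : A) (y : M), t2 (tri a b c) d y = t2 a (tri' b c d) y
  ay7e2 : ∀ (a b c d : A) (y : M), t2 a (tri' b c d) y = t2 a b (t2 c d y)
  ay8a : ∀ (u : M) (b c d e : A), t0 u (tri b c d) e = t0 (s0 u b c) d e
  ay8b : ∀ (a : A) (v : M) (c d e : A), t1 a (t0 v c d) e = t0 (s1 a v c) d e
  ay8c : ∀ (a b : A) (w : M) (d e : A), t1 a (t1 b w d) e = t0 (s2 a b w) d e
  ay8d : ∀ (a b c : A) (x : M) (e : A), t1 a (t2 b c x) e = t1 (tri' a b c) x e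
  ay8e : ∀ (a b c d : A) (y : M), t2 a (tri b c d) y = t2 (tri' a b c) d y
  ay9a1 : ∀ (u : M) (b c d e : A), s0 (s0 u b c) d e = s0 u (tri b c d) e
  ay9a2 : ∀ (u : M) (b c d e : A), s0 u (tri b c d) e = s0 u b (tri' c d e)
  ay9b1 : ∀ (a : A) (v : M) (c d e : A), s0 (s1 a v c) d e = s1 a (t0 v c d) e
  ay9b2 : ∀ (a : A) (v : M) (c d e : A), s1 a (t0 v c d) e = s1 a v (tri' c d e)
  ay9c1 : ∀ (a b : A) (w : M) (d e : A), s0 (s2 a b w) d e = s1 a (t1 b w d) e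
  ay9c2 : ∀ (a b : A) (w : M) (d e : A), s1 a (t1 b w d) e = s2 a b (s0 w d e)
  ay9d1 : ∀ (a b c : A) (x : M) (e : A), s1 (tri' a b c) x e = s1 a (t2 b c x) e
  ay9d2 : ∀ (a b c : A) (x : M) (e : A), s1 a (t2 b c x) e = s2 a b (s1 c x e)
  ay9e1 : ∀ (a b c d : A) (y : M), s2 (tri' a b c) d y = s2 a (tri b c d) y
  ay9e2 : ∀ (a b c d : A) (y : M), s2 a (tri b c d) y = s2 a b (s2 c d y)
  ay10a : ∀ (u : M) (b c d e : A), s0 u (tri' b c d) e = s0 u b (tri c d e)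
  ay10b : ∀ (a : A) (v : M) (c d e : A), s1 a (s0 v c d) e = s1 a v (tri c d e)
  ay10c : ∀ (a b : A) (w : M) (d e : A), s1 a (s1 b w d) e = s2 a b (t0 w d e)
  ay10d : ∀ (a b c : A) (x : M) (e : A), s1 a (s2 b c x) e = s2 a b (t1 c x e)
  ay10e : ∀ (a b c d : A) (y : M), s2 a (tri' b c d) y = s2 a b (t2 c d y)
  ay11a : ∀ (u : M) (b c d e : A), t0 u b (tri' c d e) = s0 (t0 u b c) d e
  ay11b : ∀ (a : A) (v : M) (c d e : A), t1 a v (tri' c d e) = s0 (t1 a v c) d e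
  ay11c : ∀ (a b : A) (w : M) (d e : A), t2 a b (s0 w d e) = s0 (t2 a b w) d e
  ay11d : ∀ (a b c : A) (x : M) (e : A), t2 a b (s1 c x e) = s1 (tri a b c) x e
  ay11e : ∀ (a b c d : A) (y : M), t2 a b (s2 c d y) = s2 (tri a b c) d y

/-- A relative Rota-Baxter operator `R : M → A` on the associative-Yamaguti algebra
`(A, mul, tri, tri')` with respect to the representation
`(M, al, ar, t0, t1, t2, s0, s1, s2)`. -/
def IsRelRB {k A M : Type*} [Field k] [AddCommGroup A] [Module k A]
    [AddCommGroup M] [Module k M]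
    (mul : A →ₗ[k] A →ₗ[k] A) (tri tri' : A →ₗ[k] A →ₗ[k] A →ₗ[k] A)
    (al : A →ₗ[k] M →ₗ[k] M) (ar : M →ₗ[k] A →ₗ[k] M)
    (t0 : M →ₗ[k] A →ₗ[k] A →ₗ[k] M) (t1 : A →ₗ[k] M →ₗ[k] A →ₗ[k] M)
    (t2 : A →ₗ[k] A →ₗ[k] M →ₗ[k] M)
    (s0 : M →ₗ[k] A →ₗ[k] A →ₗ[k] M) (s1 : A →ₗ[k] M →ₗ[k] A →ₗ[k] M)
    (s2 : A →ₗ[k] A →ₗ[k] M →ₗ[k] M)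
    (R : M →ₗ[k] A) : Prop :=
  (∀ u v : M, mul (R u) (R v) = R (al (R u) v + ar u (R v))) ∧
  (∀ u v w : M,
    tri (R u) (R v) (R w) = R (t2 (R u) (R v) w + t1 (R u) v (R w) + t0 u (R v) (R w))) ∧
  (∀ u v w : M,
    tri' (R u) (R v) (R w) = R (s2 (R u) (R v) w + s1 (R u) v (R w) + s0 u (R v) (R w)))

/-- A dendriform-Yamaguti algebra structure: bilinear operations `pl` (`≺`), `pr` (`≻`)
and trilinear operations `T1, T2, T3` (`{ , , }_[1],[2],[3]`) and `S1, S2, S3`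
(`⦃ , , ⦄_[1],[2],[3]`) satisfying the identities (DY1A)-(DY11E). -/
structure IsDendYamaguti {k D : Type*} [Field k] [AddCommGroup D] [Module k D]
    (pl pr : D →ₗ[k] D →ₗ[k] D)
    (T1 T2 T3 S1 S2 S3 : D →ₗ[k] D →ₗ[k] D →ₗ[k] D) : Prop where
  dy1a : ∀ a b c : D, pl (pl a b) c - pl a (pl b c + pr b c) + T1 a b c - S1 a b c = 0
  dy1b : ∀ a b c : D, pl (pr a b) c - pr a (pl b c) + T2 a b c - S2 a b c = 0
  dy1c : ∀ a b c : D, pr (pl a b + pr a b) c - pr a (pr b c) + T3 a b c - S3 a b c = 0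
  dy2a : ∀ a b c d : D, T1 (pl a b) c d = T1 a (pl b c + pr b c) d
  dy2b : ∀ a b c d : D, T1 (pr a b) c d = T2 a (pl b c) d
  dy2c : ∀ a b c d : D, T2 (pl a b + pr a b) c d = T2 a (pr b c) d
  dy2d : ∀ a b c d : D, T3 (pl a b + pr a b) c d = T3 a (pl b c + pr b c) d
  dy3a : ∀ a b c d : D, T1 a b (pl c d + pr c d) = pl (T1 a b c) d
  dy3b : ∀ a b c d : D, T2 a b (pl c d + pr c d) = pl (T2 a b c) d
  dy3c : ∀ a b c d : D, T3 a b (pl c d) = pl (T3 a b c) d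
  dy3d : ∀ a b c d : D, T3 a b (pr c d) = pr (T1 a b c + T2 a b c + T3 a b c) d
  dy4a : ∀ a b c d : D, S1 (pl a b) c d = pl a (S1 b c d + S2 b c d + S3 b c d)
  dy4b : ∀ a b c d : D, S1 (pr a b) c d = pr a (S1 b c d)
  dy4c : ∀ a b c d : D, S2 (pl a b + pr a b) c d = pr a (S2 b c d)
  dy4d : ∀ a b c d : D, S3 (pl a b + pr a b) c d = pr a (S3 b c d)
  dy5a : ∀ a b c d : D, S1 a (pl b c + pr b c) d = S1 a b (pl c d + pr c d)
  dy5b : ∀ a b c d : D, S2 a (pl b c) d = S2 a b (pl c d + pr c d)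
  dy5c : ∀ a b c d : D, S2 a (pr b c) d = S3 a b (pl c d)
  dy5d : ∀ a b c d : D, S3 a (pl b c + pr b c) d = S3 a b (pr c d)
  dy6a : ∀ a b c d : D, pl a (T1 b c d + T2 b c d + T3 b c d) = pl (S1 a b c) d
  dy6b : ∀ a b c d : D, pr a (T1 b c d) = pl (S2 a b c) d
  dy6c : ∀ a b c d : D, pr a (T2 b c d) = pl (S3 a b c) d
  dy6d : ∀ a b c d : D, pr a (T3 b c d) = pr (S1 a b c + S2 a b c + S3 a b c) d
  dy7a1 : ∀ a b c d e : D, T1 (T1 a b c) d e = T1 a (S1 b c d + S2 b c d + S3 b c d) e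
  dy7a2 : ∀ a b c d e : D,
    T1 a (S1 b c d + S2 b c d + S3 b c d) e = T1 a b (T1 c d e + T2 c d e + T3 c d e)
  dy7b1 : ∀ a b c d e : D, T1 (T2 a b c) d e = T2 a (S1 b c d) e
  dy7b2 : ∀ a b c d e : D, T2 a (S1 b c d) e = T2 a b (T1 c d e + T2 c d e + T3 c d e)
  dy7c1 : ∀ a b c d e : D, T1 (T3 a b c) d e = T2 a (S2 b c d) e
  dy7c2 : ∀ a b c d e : D, T2 a (S2 b c d) e = T3 a b (T1 c d e)
  dy7d1 : ∀ a b c d e : D, T2 (T1 a b c + T2 a b c + T3 a b c) d e = T2 a (S3 b c d) e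
  dy7d2 : ∀ a b c d e : D, T2 a (S3 b c d) e = T3 a b (T2 c d e)
  dy7e1 : ∀ a b c d e : D,
    T3 (T1 a b c + T2 a b c + T3 a b c) d e = T3 a (S1 b c d + S2 b c d + S3 b c d) e
  dy7e2 : ∀ a b c d e : D, T3 a (S1 b c d + S2 b c d + S3 b c d) e = T3 a b (T3 c d e)
  dy8a : ∀ a b c d e : D, T1 a (T1 b c d + T2 b c d + T3 b c d) e = T1 (S1 a b c) d e
  dy8b : ∀ a b c d e : D, T2 a (T1 b c d) e = T1 (S2 a b c) d e
  dy8c : ∀ a b c d e : D, T2 a (T2 b c d) e = T1 (S3 a b c) d e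
  dy8d : ∀ a b c d e : D, T2 a (T3 b c d) e = T2 (S1 a b c + S2 a b c + S3 a b c) d e
  dy8e : ∀ a b c d e : D,
    T3 a (T1 b c d + T2 b c d + T3 b c d) e = T3 (S1 a b c + S2 a b c + S3 a b c) d e
  dy9a1 : ∀ a b c d e : D, S1 (S1 a b c) d e = S1 a (T1 b c d + T2 b c d + T3 b c d) e
  dy9a2 : ∀ a b c d e : D,
    S1 a (T1 b c d + T2 b c d + T3 b c d) e = S1 a b (S1 c d e + S2 c d e + S3 c d e)
  dy9b1 : ∀ a b c d e : D, S1 (S2 a b c) d e = S2 a (T1 b c d) e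
  dy9b2 : ∀ a b c d e : D, S2 a (T1 b c d) e = S2 a b (S1 c d e + S2 c d e + S3 c d e)
  dy9c1 : ∀ a b c d e : D, S1 (S3 a b c) d e = S2 a (T2 b c d) e
  dy9c2 : ∀ a b c d e : D, S2 a (T2 b c d) e = S3 a b (S1 c d e)
  dy9d1 : ∀ a b c d e : D, S2 (S1 a b c + S2 a b c + S3 a b c) d e = S2 a (T3 b c d) e
  dy9d2 : ∀ a b c d e : D, S2 a (T3 b c d) e = S3 a b (S2 c d e)
  dy9e1 : ∀ a b c d e : D,
    S3 (S1 a b c + S2 a b c + S3 a b c) d e = S3 a (T1 b c d + T2 b c d + T3 b c d) e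
  dy9e2 : ∀ a b c d e : D, S3 a (T1 b c d + T2 b c d + T3 b c d) e = S3 a b (S3 c d e)
  dy10a : ∀ a b c d e : D,
    S1 a (S1 b c d + S2 b c d + S3 b c d) e = S1 a b (T1 c d e + T2 c d e + T3 c d e)
  dy10b : ∀ a b c d e : D, S2 a (S1 b c d) e = S2 a b (T1 c d e + T2 c d e + T3 c d e)
  dy10c : ∀ a b c d e : D, S2 a (S2 b c d) e = S3 a b (T1 c d e)
  dy10d : ∀ a b c d e : D, S2 a (S3 b c d) e = S3 a b (T2 c d e)
  dy10e : ∀ a b c d e : D, S3 a (S1 b c d + S2 b c d + S3 b c d) e = S3 a b (T3 c d e)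
  dy11a : ∀ a b c d e : D, T1 a b (S1 c d e + S2 c d e + S3 c d e) = S1 (T1 a b c) d e
  dy11b : ∀ a b c d e : D, T2 a b (S1 c d e + S2 c d e + S3 c d e) = S1 (T2 a b c) d e
  dy11c : ∀ a b c d e : D, T3 a b (S1 c d e) = S1 (T3 a b c) d e
  dy11d : ∀ a b c d e : D, T3 a b (S2 c d e) = S2 (T1 a b c + T2 a b c + T3 a b c) d e
  dy11e : ∀ a b c d e : D, T3 a b (S3 c d e) = S3 (T1 a b c + T2 a b c + T3 a b c) d e

/-- Precomposition of a trilinear map with a linear map in each argument. -/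
def LinearMap.compTri {k X Y Z P X' Y' Z' : Type*} [CommSemiring k]
    [AddCommMonoid X] [Module k X] [AddCommMonoid Y] [Module k Y] [AddCommMonoid Z] [Module k Z]
    [AddCommMonoid P] [Module k P] [AddCommMonoid X'] [Module k X']
    [AddCommMonoid Y'] [Module k Y'] [AddCommMonoid Z'] [Module k Z']
    (f : X →ₗ[k] Y →ₗ[k] Z →ₗ[k] P) (p : X' →ₗ[k] X) (q : Y' →ₗ[k] Y) (r : Z' →ₗ[k] Z) :
    X' →ₗ[k] Y' →ₗ[k] Z' →ₗ[k] P :=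
  (f.compl₁₂ p q).compr₂ (LinearMap.lcomp k P r)

theorem LinearMap.compTri_apply {k X Y Z P X' Y' Z' : Type*} [CommSemiring k]
    [AddCommMonoid X] [Module k X] [AddCommMonoid Y] [Module k Y] [AddCommMonoid Z] [Module k Z]
    [AddCommMonoid P] [Module k P] [AddCommMonoid X'] [Module k X']
    [AddCommMonoid Y'] [Module k Y'] [AddCommMonoid Z'] [Module k Z']
    (f : X →ₗ[k] Y →ₗ[k] Z →ₗ[k] P) (p : X' →ₗ[k] X) (q : Y' →ₗ[k] Y) (r : Z' →ₗ[k] Z)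
    (x : X') (y : Y') (z : Z') : f.compTri p q r x y z = f (p x) (q y) (r z) :=
  rfl

/-- a relative Rota-Baxter operator `R : M → A` on an
associative-Yamaguti algebra induces a dendriform-Yamaguti algebra structure on `M`. -/
theorem relRB_induces_dendYamaguti {k A M : Type*} [Field k] [CharZero k]
    [AddCommGroup A] [Module k A] [AddCommGroup M] [Module k M]
    (mul : A →ₗ[k] A →ₗ[k] A) (tri tri' : A →ₗ[k] A →ₗ[k] A →ₗ[k] A)
    (al : A →ₗ[k] M →ₗ[k] M) (ar : M →ₗ[k] A →ₗ[k] M)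
    (t0 : M →ₗ[k] A →ₗ[k] A →ₗ[k] M) (t1 : A →ₗ[k] M →ₗ[k] A →ₗ[k] M)
    (t2 : A →ₗ[k] A →ₗ[k] M →ₗ[k] M)
    (s0 : M →ₗ[k] A →ₗ[k] A →ₗ[k] M) (s1 : A →ₗ[k] M →ₗ[k] A →ₗ[k] M)
    (s2 : A →ₗ[k] A →ₗ[k] M →ₗ[k] M)
    (hA : IsAssYamaguti mul tri tri')
    (hM : IsAssYRep mul tri tri' al ar t0 t1 t2 s0 s1 s2)
    (R : M →ₗ[k] A)
    (hR : IsRelRB mul tri tri' al ar t0 t1 t2 s0 s1 s2 R) :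
    ∃ (pl pr : M →ₗ[k] M →ₗ[k] M) (T1 T2 T3 S1 S2 S3 : M →ₗ[k] M →ₗ[k] M →ₗ[k] M),
      (∀ u v : M, pl u v = ar u (R v)) ∧
      (∀ u v : M, pr u v = al (R u) v) ∧
      (∀ u v w : M, T1 u v w = t0 u (R v) (R w)) ∧
      (∀ u v w : M, T2 u v w = t1 (R u) v (R w)) ∧
      (∀ u v w : M, T3 u v w = t2 (R u) (R v) w) ∧
      (∀ u v w : M, S1 u v w = s0 u (R v) (R w)) ∧
      (∀ u v w : M, S2 u v w = s1 (R u) v (R w)) ∧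
      (∀ u v w : M, S3 u v w = s2 (R u) (R v) w) ∧
      IsDendYamaguti pl pr T1 T2 T3 S1 S2 S3 := by
  obtain ⟨hmul, htri, htri'⟩ := hR
  have Rmul (u v : M) : R (ar u (R v) + al (R u) v) = mul (R u) (R v) := by
    rw [hmul, add_comm]
  have Rtri (u v w : M) :
      R (t0 u (R v) (R w) + t1 (R u) v (R w) + t2 (R u) (R v) w) =
        tri (R u) (R v) (R w) := by
    rw [htri]; congr 1; abel
  have Rtri' (u v w : M) :
      R (s0 u (R v) (R w) + s1 (R u) v (R w) + s2 (R u) (R v) w) =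
        tri' (R u) (R v) (R w) := by
    rw [htri']; congr 1; abel
  refine ⟨ar.compl₂ R, al ∘ₗ R, t0.compTri .id R R, t1.compTri R .id R, t2.compTri R R .id,
    s0.compTri .id R R, s1.compTri R .id R, s2.compTri R R .id,
    fun _ _ => rfl, fun _ _ => rfl, fun _ _ _ => rfl, fun _ _ _ => rfl, fun _ _ _ => rfl,
    fun _ _ _ => rfl, fun _ _ _ => rfl, fun _ _ _ => rfl, ?_⟩
  constructor <;> intros <;>
    simp only [LinearMap.compl₂_apply, LinearMap.comp_apply, LinearMap.compTri_apply,
      LinearMap.id_apply, Rmul, Rtri, Rtri']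
  exacts [
    hM.ay1a .., hM.ay1b .., hM.ay1c .., hM.ay2a .., hM.ay2b .., hM.ay2c .., hM.ay2d ..,
    hM.ay3a .., hM.ay3b .., hM.ay3c .., hM.ay3d .., hM.ay4a .., hM.ay4b .., hM.ay4c ..,
    hM.ay4d .., hM.ay5a .., hM.ay5b .., hM.ay5c .., hM.ay5d .., hM.ay6a .., hM.ay6b ..,
    hM.ay6c .., hM.ay6d .., hM.ay7a1 .., hM.ay7a2 .., hM.ay7b1 .., hM.ay7b2 .., hM.ay7c1 ..,
    hM.ay7c2 .., hM.ay7d1 .., hM.ay7d2 .., hM.ay7e1 .., hM.ay7e2 .., hM.ay8a .., hM.ay8b ..,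
    hM.ay8c .., hM.ay8d .., hM.ay8e .., hM.ay9a1 .., hM.ay9a2 .., hM.ay9b1 .., hM.ay9b2 ..,
    hM.ay9c1 .., hM.ay9c2 .., hM.ay9d1 .., hM.ay9d2 .., hM.ay9e1 .., hM.ay9e2 .., hM.ay10a ..,
    hM.ay10b .., hM.ay10c .., hM.ay10d .., hM.ay10e .., hM.ay11a .., hM.ay11b .., hM.ay11c ..,
    hM.ay11d .., hM.ay11e ..]
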